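/- Let E be an L_{∞,λ} space, F a Hilbert space, and f : E → F analytic at a ∈ E. Then f is almost 2-summing at a. -/

import Mathlib

open MeasureTheory Filter Finset

/-- The weak ℓ_q norm of a finite family: `sup_{‖φ‖≤1} (∑ |φ x_j|^q)^{1/q}`. -/
noncomputable def weakNorm {E : Type*} [NormedAddCommGroup E] [NormedSpace ℝ E]
    (q : ℝ) {k : ℕ} (x : Fin k → E) : ℝ :=
  sSup {s : ℝ | ∃ φ : E →L[ℝ] ℝ, ‖φ‖ ≤ 1 ∧ s = (∑ j, |φ (x j)| ^ q) ^ (1 / q)}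

/-- The weak ℓ_q norm of a sequence. -/
noncomputable def weakNormSeq {E : Type*} [NormedAddCommGroup E] [NormedSpace ℝ E]
    (q : ℝ) (x : ℕ → E) : ℝ :=
  sSup {s : ℝ | ∃ φ : E →L[ℝ] ℝ, ‖φ‖ ≤ 1 ∧ s = (∑' j, |φ (x j)| ^ q) ^ (1 / q)}

/-- Unconditionally q-summable sequences: weakly q-summable with weak norms of tails → 0. -/
def UncondSummable {E : Type*} [NormedAddCommGroup E] [NormedSpace ℝ E]
    (q : ℝ) (x : ℕ → E) : Prop :=
  (∀ φ : E →L[ℝ] ℝ, Summable fun j => |φ (x j)| ^ q) ∧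
    Tendsto (fun m => weakNormSeq q fun j => x (j + m)) atTop (nhds 0)

/-- The Rademacher functions on [0,1]. -/
noncomputable def rademacher (j : ℕ) (t : ℝ) : ℝ :=
  if Int.fract ((2 : ℝ) ^ j * t) < 1 / 2 then 1 else -1

/-- `(∫_0^1 ‖∑_j r_j(t) y_j‖² dt)^{1/2}` for a finite family `y` in `F`. -/
noncomputable def radNorm {F : Type*} [NormedAddCommGroup F] [NormedSpace ℝ F]
    {k : ℕ} (y : Fin k → F) : ℝ :=
  (∫ t in (0:ℝ)..1, ‖∑ j : Fin k, rademacher (j : ℕ) t • y j‖ ^ 2) ^ ((1:ℝ) / 2)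

/-- `f` is almost p-summing at `a`. -/
def AlmostSummingAt {E F : Type*} [NormedAddCommGroup E] [NormedSpace ℝ E]
    [NormedAddCommGroup F] [NormedSpace ℝ F] (p : ℝ) (f : E → F) (a : E) : Prop :=
  ∃ C > 0, ∃ ε > 0, ∃ r > 0, ∀ (k : ℕ) (x : Fin k → E), weakNorm p x < ε →
    radNorm (fun j => f (a + x j) - f a) ≤ C * weakNorm p x ^ r

/-- `f` is absolutely (p,q)-summing at `a`. -/
def AbsSummingAt {E F : Type*} [NormedAddCommGroup E] [NormedSpace ℝ E]
    [NormedAddCommGroup F] [NormedSpace ℝ F] (p q : ℝ) (f : E → F) (a : E) : Prop :=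
  ∃ M > 0, ∃ δ > 0, ∃ r > 0, ∀ (k : ℕ) (x : Fin k → E), weakNorm q x < δ →
    (∑ j, ‖f (a + x j) - f a‖ ^ p) ≤ M * weakNorm q x ^ r

/-- `E` is an `L_{∞,λ}` space: every finite-dimensional subspace is contained in a
finite-dimensional subspace λ-isomorphic to some `ℓ_∞^m`. -/
def IsLinftySpace (lam : ℝ) (E : Type*) [NormedAddCommGroup E] [NormedSpace ℝ E] : Prop :=
  ∀ G : Subspace ℝ E, FiniteDimensional ℝ G →
    ∃ H : Subspace ℝ E, G ≤ H ∧ FiniteDimensional ℝ H ∧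
      ∃ m : ℕ, ∃ e : H ≃L[ℝ] (Fin m → ℝ),
        ‖(e : H →L[ℝ] (Fin m → ℝ))‖ * ‖(e.symm : (Fin m → ℝ) →L[ℝ] H)‖ ≤ lam

/-! ### Rademacher functions -/

lemma rademacher_shift_int (j : ℕ) (t c : ℝ) (n : ℤ) (h : (2:ℝ) ^ j * c = n) :
    rademacher j (t + c) = rademacher j t := by
  unfold rademacher
  rw [mul_add, h, Int.fract_add_intCast]

lemma rademacher_shift_half (i : ℕ) (t c : ℝ) (h : (2:ℝ) ^ i * c = 1 / 2) :
    rademacher i (t + c) = - rademacher i t := by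
  unfold rademacher
  rw [mul_add, h]
  set u := (2:ℝ) ^ i * t
  have h0 := Int.fract_nonneg u
  have h1 := Int.fract_lt_one u
  by_cases hu : Int.fract u < 1 / 2
  · have : Int.fract (u + 1 / 2) = Int.fract u + 1 / 2 := by
      rw [Int.fract_eq_iff]
      refine ⟨by linarith, by linarith, ⌊u⌋, ?_⟩
      have := Int.self_sub_floor u
      linarith
    rw [this, if_pos hu, if_neg (by linarith)]
  · have : Int.fract (u + 1 / 2) = Int.fract u - 1 / 2 := by
      rw [Int.fract_eq_iff]
      refine ⟨by linarith, by linarith, ⌊u⌋ + 1, ?_⟩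
      have := Int.self_sub_floor u
      push_cast
      linarith
    rw [this, if_neg hu, if_pos (by linarith)]
    norm_num

lemma rademacher_sq (j : ℕ) (t : ℝ) : rademacher j t * rademacher j t = 1 := by
  unfold rademacher
  split_ifs <;> norm_num

lemma rademacher_measurable (j : ℕ) : Measurable (rademacher j) := by
  unfold rademacher
  refine Measurable.ite ?_ measurable_const measurable_const
  exact measurableSet_lt (measurable_fract.comp (measurable_const.mul measurable_id))
    measurable_const

lemma rademacher_abs (j : ℕ) (t : ℝ) : |rademacher j t| = 1 := by
  unfold rademacher
  split_ifs <;> norm_num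

lemma rademacher_mul_intervalIntegrable (i j : ℕ) (a b : ℝ) :
    IntervalIntegrable (fun t => rademacher i t * rademacher j t) volume a b := by
  refine IntervalIntegrable.mono_fun (g := fun t => rademacher i t * rademacher j t)
    (f := fun _ => (1:ℝ)) intervalIntegrable_const ?_ ?_
  · exact ((rademacher_measurable i).mul (rademacher_measurable j)).aestronglyMeasurable
  · refine Filter.Eventually.of_forall fun t => ?_
    simp [rademacher_abs]

lemma rademacher_orth_lt {i j : ℕ} (hij : i < j) :
    ∫ t in (0:ℝ)..1, rademacher i t * rademacher j t = 0 := by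
  set g : ℝ → ℝ := fun t => rademacher i t * rademacher j t with hg
  have hper : Function.Periodic g 1 := by
    intro t
    simp only [hg]
    rw [rademacher_shift_int i t 1 (2 ^ i) (by push_cast; ring),
      rademacher_shift_int j t 1 (2 ^ j) (by push_cast; ring)]
  have hflip : ∀ t, g (t + 1 / 2 ^ (i + 1)) = - g t := by
    intro t
    obtain ⟨d, rfl⟩ := Nat.exists_eq_add_of_lt hij
    simp only [hg]
    rw [rademacher_shift_half i t _ (by field_simp; ring),
      rademacher_shift_int (i + d + 1) t _ (2 ^ d) (by push_cast; field_simp; ring)]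
    ring
  have h1 : ∫ t in (0:ℝ)..1, g (t + 1 / 2 ^ (i + 1)) = ∫ t in (0:ℝ)..1, g t := by
    rw [intervalIntegral.integral_comp_add_right]
    have := hper.intervalIntegral_add_eq (0 + 1 / 2 ^ (i + 1)) 0
    rw [zero_add (1:ℝ)] at this
    rw [← this]
    congr 1
    ring
  simp only [hflip, intervalIntegral.integral_neg] at h1
  linarith

lemma rademacher_orth (i j : ℕ) :
    ∫ t in (0:ℝ)..1, rademacher i t * rademacher j t = if i = j then 1 else 0 := by
  rcases lt_trichotomy i j with h | h | h
  · rw [if_neg h.ne, rademacher_orth_lt h]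
  · subst h
    simp [rademacher_sq]
  · rw [if_neg h.ne']
    refine Eq.trans ?_ (rademacher_orth_lt h)
    simp only [mul_comm]

lemma radNorm_hilbert {F : Type*} [NormedAddCommGroup F] [InnerProductSpace ℝ F]
    {k : ℕ} (y : Fin k → F) : radNorm y = (∑ j, ‖y j‖ ^ 2) ^ ((1:ℝ) / 2) := by
  unfold radNorm
  congr 1
  have h : ∀ t : ℝ, ‖∑ j : Fin k, rademacher (j : ℕ) t • y j‖ ^ 2
      = ∑ i : Fin k, ∑ j : Fin k,
        (rademacher (i : ℕ) t * rademacher (j : ℕ) t) * inner ℝ (y i) (y j) := by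
    intro t
    rw [← real_inner_self_eq_norm_sq, sum_inner]
    refine Finset.sum_congr rfl fun i _ => ?_
    rw [inner_sum]
    refine Finset.sum_congr rfl fun j _ => ?_
    rw [real_inner_smul_left, real_inner_smul_right]
    ring
  simp only [h]
  rw [intervalIntegral.integral_finsetSum]
  · refine Finset.sum_congr rfl fun i _ => ?_
    rw [intervalIntegral.integral_finsetSum]
    · simp only [intervalIntegral.integral_mul_const, rademacher_orth, Fin.val_inj]
      simp
    · intro j _
      exact (rademacher_mul_intervalIntegrable i j 0 1).mul_const _
  · intro i _
    have := IntervalIntegrable.sum (μ := volume) (a := (0:ℝ)) (b := 1) (Finset.univ : Finset (Fin k))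
      (f := fun (j : Fin k) (t : ℝ) =>
        (rademacher (i : ℕ) t * rademacher (j : ℕ) t) * inner ℝ (y i) (y j))
      (fun j _ => (rademacher_mul_intervalIntegrable i j 0 1).mul_const _)
    have h2 : (∑ j : Fin k, fun t : ℝ =>
        (rademacher (i : ℕ) t * rademacher (j : ℕ) t) * inner ℝ (y i) (y j)) = fun t : ℝ =>
        ∑ j : Fin k, (rademacher (i : ℕ) t * rademacher (j : ℕ) t) * inner ℝ (y i) (y j) := by
      ext t
      simp
    rw [h2] at this
    exact this

/-! ### Signs on the finite cube and Riesz products -/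

/-- sign attached to a Boolean -/
def bsgn (b : Bool) : ℝ := if b then 1 else -1

lemma cube_prod {k : ℕ} {R : Type*} [CommRing R] (g : Fin k → Bool → R) :
    ∑ s : Fin k → Bool, ∏ j, g j (s j) = ∏ j, (g j true + g j false) := by
  have := Finset.prod_univ_sum (fun _ : Fin k => (Finset.univ : Finset Bool)) g
  simp only [Fintype.piFinset_univ] at this
  rw [← this]
  simp

lemma cube_orth {k : ℕ} (i l : Fin k) :
    ∑ s : Fin k → Bool, bsgn (s i) * bsgn (s l) = if i = l then 2 ^ k else 0 := by
  split_ifs with h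
  · subst h
    have : ∀ b, bsgn b * bsgn b = 1 := by intro b; cases b <;> simp [bsgn]
    simp [this]
  · have h1 : ∀ s : Fin k → Bool, bsgn (s i) * bsgn (s l)
        = ∏ j, ((if j = i then bsgn (s j) else 1) * (if j = l then bsgn (s j) else 1)) := by
      intro s
      rw [Finset.prod_mul_distrib]
      simp
    simp only [h1]
    rw [cube_prod (fun j b => (if j = i then bsgn b else 1) * (if j = l then bsgn b else 1))]
    refine Finset.prod_eq_zero (Finset.mem_univ i) ?_
    simp [h, bsgn]

/-- the Riesz product -/
noncomputable def riesz {k : ℕ} (z : Fin k → ℝ) (s : Fin k → Bool) : ℂ :=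
  ∏ j, (1 + Complex.I * ((bsgn (s j) * z j : ℝ) : ℂ))

lemma riesz_coeff {k : ℕ} (z : Fin k → ℝ) (l : Fin k) :
    ∑ s : Fin k → Bool, bsgn (s l) * (riesz z s).im = 2 ^ k * z l := by
  have h1 : ∀ s : Fin k → Bool, ((bsgn (s l) : ℝ) : ℂ) * riesz z s
      = ∏ j, ((if j = l then ((bsgn (s j) : ℝ) : ℂ) else 1) *
          (1 + Complex.I * ((bsgn (s j) * z j : ℝ) : ℂ))) := by
    intro s
    rw [Finset.prod_mul_distrib]
    simp [riesz]
  have h2 : ∑ s : Fin k → Bool, ((bsgn (s l) : ℝ) : ℂ) * riesz z s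
      = 2 ^ k * (Complex.I * z l) := by
    simp only [h1]
    rw [cube_prod (fun j b => ((if j = l then ((bsgn b : ℝ) : ℂ) else 1) *
          (1 + Complex.I * ((bsgn b * z j : ℝ) : ℂ))))]
    have h3 : ∀ j, ((if j = l then ((bsgn true : ℝ) : ℂ) else 1) *
          (1 + Complex.I * ((bsgn true * z j : ℝ) : ℂ))) +
          ((if j = l then ((bsgn false : ℝ) : ℂ) else 1) *
          (1 + Complex.I * ((bsgn false * z j : ℝ) : ℂ)))
          = 2 * (if j = l then Complex.I * z l else 1) := by
      intro j
      split_ifs with h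
      · subst h; simp [bsgn]; ring
      · simp [bsgn]; ring
    simp only [h3]
    rw [Finset.prod_mul_distrib]
    simp
  have h4 := congrArg Complex.im h2
  rw [Complex.im_sum] at h4
  simp only [Complex.im_ofReal_mul] at h4
  rw [h4]
  have : (2 ^ k * (Complex.I * (z l : ℂ))) = (((2 ^ k * z l : ℝ)) : ℂ) * Complex.I := by
    push_cast; ring
  rw [this]
  simp only [Complex.im_ofReal_mul, Complex.I_im, mul_one]

lemma riesz_bound {k : ℕ} (z : Fin k → ℝ) (hz : ∑ j, z j ^ 2 ≤ 1) (s : Fin k → Bool) :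
    (riesz z s).im ^ 2 ≤ Real.exp 1 := by
  have h1 : (riesz z s).im ^ 2 ≤ Complex.normSq (riesz z s) := by
    rw [Complex.normSq_apply]; nlinarith [sq_nonneg (riesz z s).re]
  refine h1.trans ?_
  unfold riesz
  rw [map_prod]
  have h2 : ∀ j, Complex.normSq (1 + Complex.I * ((bsgn (s j) * z j : ℝ) : ℂ))
      ≤ Real.exp (z j ^ 2) := by
    intro j
    have : Complex.normSq (1 + Complex.I * ((bsgn (s j) * z j : ℝ) : ℂ)) = z j ^ 2 + 1 := by
      rw [Complex.normSq_apply]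
      cases s j <;> simp [bsgn] <;> ring
    rw [this]
    exact Real.add_one_le_exp _
  calc _ ≤ ∏ j, Real.exp (z j ^ 2) :=
        Finset.prod_le_prod (fun j _ => Complex.normSq_nonneg _) (fun j _ => h2 j)
    _ = Real.exp (∑ j, z j ^ 2) := (Real.exp_sum _ _).symm
    _ ≤ Real.exp 1 := Real.exp_le_exp.2 hz

/-- Bessel's inequality on the cube, unnormalised. -/
lemma cube_bessel {G : Type*} [NormedAddCommGroup G] [InnerProductSpace ℝ G] {k : ℕ}
    (S : (Fin k → Bool) → G) (y : Fin k → G)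
    (hy : ∀ l, ∑ s, bsgn (s l) • S s = (2:ℝ) ^ k • y l) :
    2 ^ k * ∑ l, ‖y l‖ ^ 2 ≤ ∑ s, ‖S s‖ ^ 2 := by
  have h0 : 0 ≤ ∑ s, ‖S s - ∑ l, bsgn (s l) • y l‖ ^ 2 :=
    Finset.sum_nonneg fun _ _ => sq_nonneg _
  have h1 : ∑ s, inner ℝ (S s) (∑ l, bsgn (s l) • y l) = 2 ^ k * ∑ l, ‖y l‖ ^ 2 := by
    simp only [inner_sum]
    rw [Finset.sum_comm, Finset.mul_sum]
    refine Finset.sum_congr rfl fun l _ => ?_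
    have : ∀ s : Fin k → Bool, inner ℝ (S s) (bsgn (s l) • y l)
        = inner ℝ (bsgn (s l) • S s) (y l) := by
      intro s; rw [real_inner_smul_left, real_inner_smul_right]
    simp only [this]
    rw [← sum_inner, hy, real_inner_smul_left, real_inner_self_eq_norm_sq]
  have h2 : ∑ s : Fin k → Bool, ‖∑ l, bsgn (s l) • y l‖ ^ 2 = 2 ^ k * ∑ l, ‖y l‖ ^ 2 := by
    have h : ∀ s : Fin k → Bool, ‖∑ l, bsgn (s l) • y l‖ ^ 2
      = ∑ i, ∑ j, (bsgn (s i) * bsgn (s j)) * inner ℝ (y i) (y j) := by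
      intro t
      rw [← real_inner_self_eq_norm_sq, sum_inner]
      refine Finset.sum_congr rfl fun i _ => ?_
      rw [inner_sum]
      refine Finset.sum_congr rfl fun j _ => ?_
      rw [real_inner_smul_left, real_inner_smul_right]
      ring
    simp only [h]
    rw [Finset.sum_comm, Finset.mul_sum]
    refine Finset.sum_congr rfl fun i _ => ?_
    rw [Finset.sum_comm]
    simp only [← Finset.sum_mul, cube_orth]
    simp
  simp only [norm_sub_sq_real, Finset.sum_add_distrib, Finset.sum_sub_distrib,
    ← Finset.mul_sum] at h0
  rw [h1, h2] at h0
  linarith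

/-- Little Grothendieck, normalised. -/
lemma little_groth_one {G : Type*} [NormedAddCommGroup G] [InnerProductSpace ℝ G] {k m : ℕ}
    (v : (Fin m → ℝ) →ₗ[ℝ] G) (M : ℝ) (hM : 0 ≤ M) (hv : ∀ z, ‖v z‖ ≤ M * ‖z‖)
    (z : Fin k → Fin m → ℝ) (hz : ∀ i, ∑ j, z j i ^ 2 ≤ 1) :
    ∑ j, ‖v (z j)‖ ^ 2 ≤ Real.exp 1 * M ^ 2 := by
  have key := cube_bessel
    (fun s => v (fun i => (riesz (fun j => z j i) s).im)) (fun j => v (z j)) (by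
      intro l
      simp only [← map_smul]
      rw [← map_sum]
      congr 1
      ext i
      simp only [Finset.sum_apply, Pi.smul_apply, smul_eq_mul]
      exact riesz_coeff (fun j => z j i) l)
  have hb : ∀ s : Fin k → Bool, ‖v (fun i => (riesz (fun j => z j i) s).im)‖ ^ 2
      ≤ Real.exp 1 * M ^ 2 := by
    intro s
    have h1 : ‖(fun i => (riesz (fun j => z j i) s).im)‖ ≤ Real.sqrt (Real.exp 1) := by
      rw [pi_norm_le_iff_of_nonneg (Real.sqrt_nonneg _)]
      intro i
      rw [Real.norm_eq_abs]
      exact Real.abs_le_sqrt (riesz_bound _ (hz i) s)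
    have h2 := (hv (fun i => (riesz (fun j => z j i) s).im)).trans
      (mul_le_mul_of_nonneg_left h1 hM)
    calc _ ≤ (M * Real.sqrt (Real.exp 1)) ^ 2 := pow_le_pow_left₀ (norm_nonneg _) h2 2
      _ = _ := by rw [mul_pow, Real.sq_sqrt (Real.exp_pos 1).le]; ring
  have hs := Finset.sum_le_sum (fun s (_ : s ∈ (Finset.univ : Finset (Fin k → Bool))) => hb s)
  simp only [Finset.sum_const, Finset.card_univ, Fintype.card_fun, Fintype.card_bool,
    Fintype.card_fin, nsmul_eq_mul] at hs
  push_cast at hs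
  have h2k : (0:ℝ) < 2 ^ k := by positivity
  exact le_of_mul_le_mul_left (key.trans hs) h2k

lemma little_groth {G : Type*} [NormedAddCommGroup G] [InnerProductSpace ℝ G] {k m : ℕ}
    (v : (Fin m → ℝ) →ₗ[ℝ] G) (M : ℝ) (hM : 0 ≤ M) (hv : ∀ z, ‖v z‖ ≤ M * ‖z‖)
    (z : Fin k → Fin m → ℝ) (W : ℝ) (hW : 0 ≤ W) (hz : ∀ i, ∑ j, z j i ^ 2 ≤ W ^ 2) :
    ∑ j, ‖v (z j)‖ ^ 2 ≤ Real.exp 1 * M ^ 2 * W ^ 2 := by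
  rcases hW.eq_or_lt with h | h
  · subst h
    have : ∀ j, z j = 0 := by
      intro j
      ext i
      have h1 := Finset.single_le_sum (f := fun j => z j i ^ 2) (fun j _ => sq_nonneg _)
        (Finset.mem_univ j)
      have h2 := hz i
      have : z j i ^ 2 ≤ 0 := by simpa using h1.trans h2
      simpa using le_antisymm this (sq_nonneg _)
    simp [this]
  · have := little_groth_one v M hM hv (fun j => W⁻¹ • z j) (by
      intro i
      simp only [Pi.smul_apply, smul_eq_mul, mul_pow]
      rw [← Finset.mul_sum]
      have := hz i
      rw [inv_pow, inv_mul_le_iff₀ (by positivity)]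
      linarith)
    simp only [map_smul, norm_smul, mul_pow] at this
    rw [← Finset.mul_sum, norm_inv, Real.norm_eq_abs, inv_pow, sq_abs,
      inv_mul_le_iff₀ (by positivity)] at this
    linarith

/-! ### The weak norm -/

lemma weakNorm_bdd {E : Type*} [NormedAddCommGroup E] [NormedSpace ℝ E]
    {k : ℕ} (x : Fin k → E) :
    BddAbove {s : ℝ | ∃ φ : E →L[ℝ] ℝ, ‖φ‖ ≤ 1 ∧
      s = (∑ j, |φ (x j)| ^ (2:ℝ)) ^ (1 / (2:ℝ))} := by
  refine ⟨(∑ j, ‖x j‖ ^ (2:ℝ)) ^ (1 / (2:ℝ)), ?_⟩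
  rintro s ⟨φ, hφ, rfl⟩
  gcongr with j
  rw [← Real.norm_eq_abs]
  exact (φ.le_opNorm _).trans (mul_le_of_le_one_left (norm_nonneg _) hφ)

lemma weakNorm_nonneg {E : Type*} [NormedAddCommGroup E] [NormedSpace ℝ E]
    {k : ℕ} (x : Fin k → E) : 0 ≤ weakNorm 2 x := by
  refine Real.sSup_nonneg ?_
  rintro s ⟨φ, hφ, rfl⟩
  positivity

lemma weakNorm_le {E : Type*} [NormedAddCommGroup E] [NormedSpace ℝ E]
    {k : ℕ} (x : Fin k → E) (φ : E →L[ℝ] ℝ) (hφ : ‖φ‖ ≤ 1) :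
    ∑ j, φ (x j) ^ 2 ≤ weakNorm 2 x ^ 2 := by
  have h := le_csSup (weakNorm_bdd x) ⟨φ, hφ, rfl⟩
  change _ ≤ weakNorm 2 x at h
  rw [← Real.sqrt_eq_rpow, Real.sqrt_le_left (weakNorm_nonneg x)] at h
  simpa using h

lemma weakNorm_le_mul {E : Type*} [NormedAddCommGroup E] [NormedSpace ℝ E]
    {k : ℕ} (x : Fin k → E) (φ : E →L[ℝ] ℝ) (c : ℝ) (hφ : ‖φ‖ ≤ c) :
    ∑ j, φ (x j) ^ 2 ≤ (c * weakNorm 2 x) ^ 2 := by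
  have hc : 0 ≤ c := (norm_nonneg _).trans hφ
  rcases hc.eq_or_lt with h | h
  · subst h
    have : φ = 0 := by simpa using le_antisymm hφ (norm_nonneg _)
    simp [this]
  · have := weakNorm_le x (c⁻¹ • φ) (by
      rw [norm_smul, norm_inv, Real.norm_of_nonneg hc, inv_mul_le_iff₀ h]; simpa using hφ)
    simp only [_root_.smul_apply, smul_eq_mul, mul_pow] at this
    rw [← Finset.mul_sum, inv_pow, inv_mul_le_iff₀ (by positivity)] at this
    rw [mul_pow]
    exact this

lemma norm_le_weakNorm {E : Type*} [NormedAddCommGroup E] [NormedSpace ℝ E]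
    {k : ℕ} (x : Fin k → E) (j : Fin k) : ‖x j‖ ≤ weakNorm 2 x := by
  obtain ⟨φ, h1, h2⟩ := exists_dual_vector'' ℝ (x j)
  have h := weakNorm_le x φ h1
  have h3 := Finset.single_le_sum (f := fun j => φ (x j) ^ 2) (fun j _ => sq_nonneg _)
        (Finset.mem_univ j)
  have h4 := h3.trans h
  simp only [h2] at h4
  exact le_of_sq_le_sq (by simpa using h4) (weakNorm_nonneg x)

/-- Linear maps from an `L_∞` space to a Hilbert space are 2-summing. -/
lemma linear_summing {E G : Type*} [NormedAddCommGroup E] [NormedSpace ℝ E]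
    [NormedAddCommGroup G] [InnerProductSpace ℝ G]
    (lam : ℝ) (hE : IsLinftySpace lam E)
    (u : E →ₗ[ℝ] G) (M : ℝ) (hM : 0 ≤ M) (hu : ∀ x, ‖u x‖ ≤ M * ‖x‖)
    {k : ℕ} (x : Fin k → E) :
    ∑ j, ‖u (x j)‖ ^ 2 ≤ Real.exp 1 * lam ^ 2 * M ^ 2 * weakNorm 2 x ^ 2 := by
  obtain ⟨H, hGH, -, m, e, he⟩ := hE (Submodule.span ℝ (Set.range x))
    (FiniteDimensional.span_of_finite ℝ (Set.finite_range x))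
  have hx : ∀ j, x j ∈ H := fun j => hGH (Submodule.subset_span ⟨j, rfl⟩)
  set a := ‖(e : H →L[ℝ] (Fin m → ℝ))‖ with ha
  set b := ‖(e.symm : (Fin m → ℝ) →L[ℝ] H)‖ with hb
  have ha0 : 0 ≤ a := ContinuousLinearMap.opNorm_nonneg _
  have hb0 : 0 ≤ b := ContinuousLinearMap.opNorm_nonneg _
  have hw := weakNorm_nonneg x
  have key := little_groth (u ∘ₗ H.subtype ∘ₗ (e.symm : (Fin m → ℝ) →L[ℝ] H).toLinearMap)
    (M * b) (by positivity) (by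
      intro z
      refine (hu _).trans ?_
      rw [mul_assoc]
      refine mul_le_mul_of_nonneg_left ?_ hM
      exact (e.symm : (Fin m → ℝ) →L[ℝ] H).le_opNorm z)
    (fun j => e ⟨x j, hx j⟩) (a * weakNorm 2 x) (by positivity) (by
      intro i
      obtain ⟨φ, hφ, hn⟩ := exists_extension_norm_eq (𝕜 := ℝ) H
        ((ContinuousLinearMap.proj (R := ℝ) (φ := fun _ : Fin m => ℝ) i).comp
          (e : H →L[ℝ] (Fin m → ℝ)))
      have h1 : ‖φ‖ ≤ a := by
        rw [hn]
        refine ContinuousLinearMap.opNorm_le_bound _ ha0 fun y => ?_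
        exact (norm_le_pi_norm (e y) i).trans
          ((e : H →L[ℝ] (Fin m → ℝ)).le_opNorm y)
      have h2 := weakNorm_le_mul x φ a h1
      have h3 : ∀ j, φ (x j) = e ⟨x j, hx j⟩ i := fun j => hφ ⟨x j, hx j⟩
      simpa only [h3] using h2)
  have hk : ∑ j, ‖u (x j)‖ ^ 2 ≤ Real.exp 1 * (M * b) ^ 2 * (a * weakNorm 2 x) ^ 2 := by
    simpa using key
  refine hk.trans ?_
  have : Real.exp 1 * (M * b) ^ 2 * (a * weakNorm 2 x) ^ 2
    = Real.exp 1 * (a * b) ^ 2 * M ^ 2 * weakNorm 2 x ^ 2 := by ring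
  rw [this]
  gcongr

/-- Multilinear maps from an `L_∞` space to a Hilbert space are multiple 2-summing. -/
lemma multi_summing {E : Type*} [NormedAddCommGroup E] [NormedSpace ℝ E]
    {G : Type*} [NormedAddCommGroup G] [InnerProductSpace ℝ G]
    (lam : ℝ) (hE : IsLinftySpace lam E) {k : ℕ} (x : Fin k → E) (n : ℕ) :
    ∀ (A : MultilinearMap ℝ (fun _ : Fin n => E) G) (M : ℝ), 0 ≤ M →
      (∀ y, ‖A y‖ ≤ M * ∏ i, ‖y i‖) →
    ∑ s : Fin n → Fin k, ‖A (fun i => x (s i))‖ ^ 2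
      ≤ M ^ 2 * (Real.exp 1 * lam ^ 2 * weakNorm 2 x ^ 2) ^ n := by
  induction n with
  | zero =>
    intro A M hM hA
    simp only [pow_zero, mul_one, Finset.univ_unique, Finset.sum_singleton]
    refine pow_le_pow_left₀ (norm_nonneg _) ?_ 2
    refine (hA _).trans ?_
    simp
  | succ n ih =>
    intro A M hM hA
    set q := Real.exp 1 * lam ^ 2 * weakNorm 2 x ^ 2 with hq
    have hq0 : 0 ≤ q := by positivity
    let u : E →ₗ[ℝ] PiLp 2 (fun _ : Fin n → Fin k => G) :=
      { toFun := fun y => WithLp.toLp 2 (fun s => A.curryLeft y (fun i => x (s i)))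
        map_add' := by intro y z; ext s; simp
        map_smul' := by intro c z; ext s; simp }
    have hnorm : ∀ y, ‖u y‖ ^ 2 = ∑ s : Fin n → Fin k,
        ‖A.curryLeft y (fun i => x (s i))‖ ^ 2 := by
      intro y
      rw [PiLp.norm_sq_eq_of_L2]
      rfl
    have hu : ∀ y, ‖u y‖ ≤ (M * Real.sqrt (q ^ n)) * ‖y‖ := by
      intro y
      refine le_of_sq_le_sq ?_ (by positivity)
      rw [hnorm]
      have := ih (A.curryLeft y) (M * ‖y‖) (by positivity) (by
        intro w
        rw [MultilinearMap.curryLeft_apply]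
        refine (hA _).trans ?_
        rw [Fin.prod_univ_succ]
        simp [mul_assoc])
      refine this.trans (le_of_eq ?_)
      rw [mul_pow, mul_pow (M * _), mul_pow M (Real.sqrt _), Real.sq_sqrt (by positivity)]
      ring
    have h := linear_summing lam hE u _ (by positivity) hu x
    simp only [hnorm] at h
    rw [mul_pow, Real.sq_sqrt (by positivity)] at h
    have h2 : ∑ s : Fin (n + 1) → Fin k, ‖A (fun i => x (s i))‖ ^ 2
        = ∑ j, ∑ s : Fin n → Fin k, ‖A.curryLeft (x j) (fun i => x (s i))‖ ^ 2 := by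
      rw [← (Fin.consEquiv (fun _ : Fin (n + 1) => Fin k)).sum_comp, Fintype.sum_prod_type]
      refine Finset.sum_congr rfl fun j _ => Finset.sum_congr rfl fun s _ => ?_
      rw [MultilinearMap.curryLeft_apply]
      congr 3
      ext i
      refine Fin.cases ?_ (fun i => ?_) i <;> simp [Fin.consEquiv]
    rw [h2]
    refine h.trans (le_of_eq ?_)
    rw [pow_succ, hq]
    ring

lemma diag_summing {E : Type*} [NormedAddCommGroup E] [NormedSpace ℝ E]
    {G : Type*} [NormedAddCommGroup G] [InnerProductSpace ℝ G]
    (lam : ℝ) (hE : IsLinftySpace lam E) {k : ℕ} (x : Fin k → E) (n : ℕ) (hn : n ≠ 0)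
    (A : ContinuousMultilinearMap ℝ (fun _ : Fin n => E) G) :
    ∑ j, ‖A (fun _ => x j)‖ ^ 2
      ≤ ‖A‖ ^ 2 * (Real.exp 1 * lam ^ 2 * weakNorm 2 x ^ 2) ^ n := by
  refine le_trans ?_ (multi_summing lam hE x n A.toMultilinearMap ‖A‖ (norm_nonneg _)
    (fun y => A.le_opNorm y))
  have : Nonempty (Fin n) := ⟨⟨0, Nat.pos_of_ne_zero hn⟩⟩
  let ι : Fin k ↪ (Fin n → Fin k) := ⟨fun j _ => j, Function.const_injective⟩
  have h := Finset.sum_map Finset.univ ι (fun s => ‖A (fun i => x (s i))‖ ^ 2)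
  change ∑ j, ‖A (fun i => x (ι j i))‖ ^ 2 ≤ _
  rw [← h]
  exact Finset.sum_le_sum_of_subset_of_nonneg (Finset.subset_univ _)
    (fun _ _ _ => sq_nonneg _)

theorem stmt15 {E F : Type*} [NormedAddCommGroup E] [NormedSpace ℝ E]
    [NormedAddCommGroup F] [InnerProductSpace ℝ F] [CompleteSpace F]
    (lam : ℝ) (hlam : 1 ≤ lam) (hE : IsLinftySpace lam E)
    (f : E → F) (a : E) (hf : AnalyticAt ℝ f a) :
    AlmostSummingAt 2 f a := by
  obtain ⟨p, R, hp⟩ := hf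
  obtain ⟨ρ, hρ0, hρR⟩ := ENNReal.lt_iff_exists_nnreal_btwn.1 hp.r_pos
  have hρ : (0:ℝ) < ρ := by exact_mod_cast hρ0
  obtain ⟨C, hC, hCb⟩ := p.norm_mul_pow_le_of_lt_radius (hρR.trans_le hp.r_le)
  set K := Real.sqrt (Real.exp 1) * lam with hK
  have hK1 : 1 ≤ K := by
    have : 1 ≤ Real.sqrt (Real.exp 1) := by
      rw [Real.one_le_sqrt]; exact Real.one_le_exp (by norm_num)
    nlinarith
  have hK2 : Real.exp 1 * lam ^ 2 = K ^ 2 := by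
    rw [hK, mul_pow, Real.sq_sqrt (Real.exp_pos 1).le]
  have hK0 : 0 < K := by linarith
  refine ⟨2 * C * K / ρ, by positivity, ρ / (2 * K), by positivity, 1, one_pos, ?_⟩
  intro k x hx
  have hw := weakNorm_nonneg x
  set w := weakNorm 2 x with hwdef
  rw [pow_one, radNorm_hilbert, ← Real.sqrt_eq_rpow]
  set q := K * w / ρ with hq
  have hq0 : 0 ≤ q := by positivity
  have hq2 : q ≤ 1 / 2 := by
    rw [lt_div_iff₀ (by positivity)] at hx
    rw [hq, div_le_iff₀ hρ]
    linarith
  have hwρ : w < ρ := by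
    rw [lt_div_iff₀ (by positivity)] at hx
    nlinarith
  let V : ℕ → PiLp 2 (fun _ : Fin k => F) := fun n =>
    WithLp.toLp 2 (fun j => p (n + 1) (fun _ => x j))
  let S : PiLp 2 (fun _ : Fin k => F) := WithLp.toLp 2 (fun j => f (a + x j) - f a)
  have hsum : HasSum V S := by
    have h1 : HasSum (fun n => (fun j => p (n + 1) (fun _ => x j) : Fin k → F))
        (fun j => f (a + x j) - f a) := by
      rw [Pi.hasSum]
      intro j
      have hj : x j ∈ Metric.eball (0:E) R := by
        rw [Metric.mem_eball, edist_zero_right]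
        refine lt_of_lt_of_le ?_ hρR.le
        rw [← ofReal_norm, ← ENNReal.ofReal_coe_nnreal]
        exact (ENNReal.ofReal_lt_ofReal_iff hρ).2 ((norm_le_weakNorm x j).trans_lt hwρ)
      have h2 := hp.hasSum hj
      rw [← hasSum_nat_add_iff' 1] at h2
      simpa [hp.coeff_zero] using h2
    exact h1.mapL (PiLp.continuousLinearEquiv 2 ℝ (fun _ : Fin k => F)).symm.toContinuousLinearMap
  have hV : ∀ n, ‖V n‖ ≤ C * q * q ^ n := by
    intro n
    have h1 : ‖V n‖ ^ 2 = ∑ j, ‖p (n + 1) (fun _ => x j)‖ ^ 2 := by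
      rw [PiLp.norm_sq_eq_of_L2]
    have h2 := diag_summing lam hE x (n + 1) (Nat.succ_ne_zero n) (p (n + 1))
    rw [← h1, hK2, ← mul_pow, ← pow_mul, mul_comm 2 (n + 1), pow_mul, ← mul_pow] at h2
    have h3 := le_of_sq_le_sq h2 (by positivity)
    refine h3.trans ?_
    have h4 := hCb (n + 1)
    have h5 : K * w = ρ * q := by rw [hq]; field_simp
    rw [← hwdef, h5, mul_pow, ← mul_assoc]
    calc _ ≤ C * q ^ (n + 1) := by gcongr
      _ = _ := by ring
  have hgeo := (hasSum_geometric_of_lt_one hq0 (by linarith : q < 1)).mul_left (C * q)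
  have hS := hsum.norm_le_of_bounded hgeo hV
  have hS2 : Real.sqrt (∑ j, ‖f (a + x j) - f a‖ ^ 2) = ‖S‖ := by
    rw [PiLp.norm_eq_of_L2]
  rw [hS2]
  refine hS.trans ?_
  have h6 : (1 - q)⁻¹ ≤ 2 := by
    rw [inv_le_comm₀ (by linarith) (by norm_num)]
    linarith
  calc C * q * (1 - q)⁻¹ ≤ C * q * 2 := by gcongr
    _ = _ := by rw [hq]; ring
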